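/- Every open cover of a hereditarily meta-Lindelöf, locally compact, scattered Tychonoff space of Cantor–Bendixson height ω₁ has a point-finite clopen refinement. -/

import Mathlib

open Set Topology Ordinal Cardinal

noncomputable section
universe u

/-- A topological space is *scattered* if every nonempty subset has a point isolated
in the subspace topology, i.e. there is an open set meeting the subset in exactly
that point. -/
def IsScattered (X : Type*) [TopologicalSpace X] : Prop :=
  ∀ S : Set X, S.Nonempty → ∃ x ∈ S, ∃ U : Set X, IsOpen U ∧ U ∩ S = {x}

/-- A space is *meta-Lindelöf* if every open cover has a point-countable open refinement. -/
def IsMetaLindelof (X : Type*) [TopologicalSpace X] : Prop :=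
  ∀ 𝒰 : Set (Set X), (∀ U ∈ 𝒰, IsOpen U) → ⋃₀ 𝒰 = Set.univ →
    ∃ 𝒱 : Set (Set X), (∀ V ∈ 𝒱, IsOpen V) ∧ ⋃₀ 𝒱 = Set.univ ∧
      (∀ V ∈ 𝒱, ∃ U ∈ 𝒰, V ⊆ U) ∧ ∀ x : X, {V ∈ 𝒱 | x ∈ V}.Countable

/-- A space is *hereditarily meta-Lindelöf* if every subspace is meta-Lindelöf. -/
def HereditarilyMetaLindelof (X : Type*) [TopologicalSpace X] : Prop :=
  ∀ S : Set X, IsMetaLindelof S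

/-- A space is *σ-discrete* if it is a countable union of subspaces, each of which is
discrete in its subspace topology. -/
def IsSigmaDiscrete (X : Type*) [TopologicalSpace X] : Prop :=
  ∃ D : ℕ → Set X, (⋃ n, D n) = Set.univ ∧ ∀ n, DiscreteTopology (D n)

/-- The Cantor–Bendixson derivatives `cbDeriv X α = X^(α)`: for each `β < α` we intersect
the set of non-isolated points of `X^(β)`.  This agrees with the usual transfinite
iteration: `X^(0) = X`, `X^(α+1)` is the set of non-isolated points of `X^(α)`, and at
limit ordinals one takes intersections. -/
def cbDeriv (X : Type*) [TopologicalSpace X] (o : Ordinal) : Set X :=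
  ⋂ p : {b : Ordinal // b < o},
    (cbDeriv X p.1 ∩ {x | x ∈ closure (cbDeriv X p.1 \ {x})})
termination_by o
decreasing_by exact p.2

/-- The Cantor–Bendixson height of a space: the least ordinal `α` with `X^(α) = ∅`. -/
def cbHeight (X : Type*) [TopologicalSpace X] : Ordinal :=
  sInf {o : Ordinal | cbDeriv X o = ∅}

/-- A space `X` is *Eberlein–Grothendieck* if it embeds into `C_p(K)`, the space of
continuous real-valued functions on a compact Hausdorff space `K` with the topology of
pointwise convergence (the subspace topology from the product topology on `K → ℝ`). -/
def EberleinGrothendieck (X : Type u) [TopologicalSpace X] : Prop :=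
  ∃ (K : Type u) (_ : TopologicalSpace K), CompactSpace K ∧ T2Space K ∧
    ∃ f : X → {g : K → ℝ // Continuous g}, IsEmbedding f

/-- The weight of a topological space: the least cardinality of a base for the topology. -/
def tweight (X : Type u) [TopologicalSpace X] : Cardinal.{u} :=
  sInf {c : Cardinal.{u} | ∃ B : Set (Set X), TopologicalSpace.IsTopologicalBasis B ∧ #B = c}

/-- A space is *locally countable* if every point has a countable open neighborhood. -/
def LocallyCountable (X : Type*) [TopologicalSpace X] : Prop :=
  ∀ x : X, ∃ U : Set X, IsOpen U ∧ x ∈ U ∧ U.Countable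

section Trimming

variable {X : Type u} {V : X → Set X} {S A : Set X}

/-- The set `V x` with the sets `V z`, `z ∈ G x`, removed. -/
def trim (V : X → Set X) (G : X → Finset X) (x : X) : Set X := V x \ ⋃ z ∈ G x, V z

lemma mem_trim {G : X → Finset X} {x y : X} :
    y ∈ trim V G x ↔ y ∈ V x ∧ ∀ z ∈ G x, y ∉ V z := by
  simp [trim]

/-- The sets `V x`, `x ∈ S`, can be trimmed along finite subsets of `S` to a point-finite
cover of `S`. -/
def HasTrimming (V : X → Set X) (S : Set X) : Prop :=
  ∃ G : X → Finset X, (∀ x ∈ S, (G x : Set X) ⊆ S) ∧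
    ∀ y ∈ S, {x ∈ S | y ∈ trim V G x}.Finite ∧ {x ∈ S | y ∈ trim V G x}.Nonempty

/-- A subset `A` of `S` is reflecting if it contains every `x ∈ S` whose set `V x` meets `A`,
and every finite pattern of memberships in the sets `V x`, `x ∈ A`, realized in `S` is
realized in `A`. -/
structure IsReflecting (V : X → Set X) (S A : Set X) : Prop where
  subset : A ⊆ S
  mem_of_mem : ∀ y ∈ A, ∀ x ∈ S, y ∈ V x → x ∈ A
  reflect : ∀ F G : Finset X, F.Nonempty → (F : Set X) ⊆ A → (G : Set X) ⊆ A →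
    (∃ y ∈ S, (∀ x ∈ F, y ∈ V x) ∧ ∀ x ∈ G, y ∉ V x) →
    ∃ y ∈ A, (∀ x ∈ F, y ∈ V x) ∧ ∀ x ∈ G, y ∉ V x

lemma IsReflecting.biUnion {ι : Type*} [LinearOrder ι] {B : ι → Set X} (hB : Monotone B)
    {s : Set ι} (h : ∀ i ∈ s, IsReflecting V S (B i)) : IsReflecting V S (⋃ i ∈ s, B i) where
  subset := iUnion₂_subset fun i hi ↦ (h i hi).subset
  mem_of_mem y hy x hx hyx := by
    obtain ⟨i, hi, hyi⟩ := mem_iUnion₂.1 hy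
    exact mem_iUnion₂.2 ⟨i, hi, (h i hi).mem_of_mem y hyi x hx hyx⟩
  reflect F G hF hFA hGA hy := by
    classical
    have hs : s.Nonempty := by
      obtain ⟨x, hx⟩ := hF
      obtain ⟨i, hi, -⟩ := mem_iUnion₂.1 (hFA hx)
      exact ⟨i, hi⟩
    have hdir : DirectedOn (fun i j ↦ B i ⊆ B j) s := fun i hi j hj ↦
      ⟨max i j, by rcases max_choice i j with h | h <;> rwa [h],
        hB (le_max_left i j), hB (le_max_right i j)⟩
    obtain ⟨i, hi, hFG⟩ := hdir.exists_mem_subset_of_finset_subset_biUnion (s := F ∪ G) hs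
      (by simpa using ⟨hFA, hGA⟩)
    rw [Finset.coe_union, union_subset_iff] at hFG
    obtain ⟨y, hyB, hy⟩ := (h i hi).reflect F G hF hFG.1 hFG.2 hy
    exact ⟨y, mem_iUnion₂.2 ⟨i, hi, hyB⟩, hy⟩

lemma mk_finset_le_of_le {α : Type u} {κ : Cardinal.{u}} (hκ : ℵ₀ ≤ κ) (h : #α ≤ κ) :
    #(Finset α) ≤ κ := by
  cases finite_or_infinite α
  · exact (lt_aleph0_of_finite _).le.trans hκ
  · rwa [mk_finset_of_infinite]

lemma exists_reflecting_closure (hV : ∀ y, {x | y ∈ V x}.Countable) (S : Set X) :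
    ∃ cl : Set X → Set X, Monotone cl ∧ ∀ B ⊆ S, IsReflecting V S (cl B) ∧ B ⊆ cl B ∧
      ∀ κ : Cardinal.{u}, ℵ₀ ≤ κ → #B ≤ κ → #(cl B) ≤ κ := by
  classical
  rcases S.eq_empty_or_nonempty with rfl | ⟨s₀, -⟩
  · exact ⟨id, monotone_id, fun B hB ↦ ⟨⟨hB, by simp, by simp⟩, subset_rfl, fun _ _ h ↦ h⟩⟩
  have hf : ∀ F G : Finset X, ∃ y, (∃ y ∈ S, (∀ x ∈ F, y ∈ V x) ∧ ∀ x ∈ G, y ∉ V x) →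
      y ∈ S ∧ (∀ x ∈ F, y ∈ V x) ∧ ∀ x ∈ G, y ∉ V x := fun F G ↦ by
    by_cases h : ∃ y ∈ S, (∀ x ∈ F, y ∈ V x) ∧ ∀ x ∈ G, y ∉ V x
    · exact ⟨h.choose, fun _ ↦ h.choose_spec⟩
    · exact ⟨s₀, fun h' ↦ (h h').elim⟩
  choose f hf using hf
  let up (C : Set X) : Set X := ⋃ b : C, {x ∈ S | b.1 ∈ V x}
  let wit (C : Set X) : Set X :=
    {y ∈ S | ∃ F G : Finset X, (F : Set X) ⊆ C ∧ (G : Set X) ⊆ C ∧ f F G = y}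
  let step (C : Set X) : Set X := C ∪ up C ∪ wit C
  have hstep (C) : C ⊆ step C := subset_union_left.trans subset_union_left
  have hstep_mono : Monotone step := fun C C' h ↦ by
    refine union_subset_union (union_subset_union h (iUnion_subset fun b x hx ↦ ?_)) ?_
    · exact mem_iUnion.2 ⟨⟨b, h b.2⟩, hx⟩
    · rintro y ⟨hy, F, G, hF, hG, rfl⟩
      exact ⟨hy, F, G, hF.trans h, hG.trans h, rfl⟩
  have hcard (C : Set X) (κ : Cardinal.{u}) (hκ : ℵ₀ ≤ κ) (hC : #C ≤ κ) : #(step C) ≤ κ := by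
    have h1 : #(up C) ≤ κ := by
      refine (mk_iUnion_le _).trans (mul_le_of_le hκ hC ?_)
      refine ciSup_le' fun b ↦ ?_
      have : {x ∈ S | b.1 ∈ V x}.Countable := (hV b.1).mono fun x hx ↦ hx.2
      exact (mk_le_aleph0_iff.2 this.to_subtype).trans hκ
    have h2 : #(wit C) ≤ κ := by
      have : wit C ⊆ range fun p : Finset C × Finset C ↦
          f (p.1.map (.subtype _)) (p.2.map (.subtype _)) := by
        rintro _ ⟨-, F, G, hF, hG, rfl⟩
        refine ⟨(F.subtype (· ∈ C), G.subtype (· ∈ C)), ?_⟩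
        simp only
        rw [Finset.subtype_map_of_mem fun x hx ↦ hF hx,
          Finset.subtype_map_of_mem fun x hx ↦ hG hx]
      refine (mk_le_mk_of_subset this).trans (mk_range_le.trans ?_)
      rw [mk_prod, Cardinal.lift_id]
      exact mul_le_of_le hκ (mk_finset_le_of_le hκ hC) (mk_finset_le_of_le hκ hC)
    exact (mk_union_le _ _).trans (add_le_of_le hκ ((mk_union_le _ _).trans
      (add_le_of_le hκ hC h1)) h2)
  let D (B : Set X) (n : ℕ) : Set X := step^[n] B
  have hD (B n) : D B (n + 1) = step (D B n) := Function.iterate_succ_apply' _ _ _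
  have hmono (B) : Monotone (D B) := monotone_nat_of_le_succ fun n ↦ by rw [hD]; exact hstep _
  refine ⟨fun B ↦ ⋃ n, D B n, fun B B' h ↦ iUnion_mono fun n ↦ hstep_mono.iterate n h,
    fun B hBS ↦ ?_⟩
  have hDS (n) : D B n ⊆ S := by
    induction n with
    | zero => exact hBS
    | succ n ih =>
      rw [hD]
      exact union_subset (union_subset ih (iUnion_subset fun b x hx ↦ hx.1)) fun x hx ↦ hx.1
  refine ⟨⟨iUnion_subset hDS, fun y hy x hx hyx ↦ ?_, fun F G _ hF hG hy ↦ ?_⟩,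
    subset_iUnion (D B) 0, fun κ hκ hB ↦ ?_⟩
  · obtain ⟨n, hn⟩ := mem_iUnion.1 hy
    refine mem_iUnion.2 ⟨n + 1, ?_⟩
    rw [hD]
    exact Or.inl (Or.inr (mem_iUnion.2 ⟨⟨y, hn⟩, hx, hyx⟩))
  · obtain ⟨n, hn⟩ := (hmono B).directed_le.exists_mem_subset_of_finset_subset_biUnion
      (s := F ∪ G) (by simpa using ⟨hF, hG⟩)
    rw [Finset.coe_union, union_subset_iff] at hn
    obtain ⟨hyS, hyFG⟩ := hf F G hy
    refine ⟨f F G, mem_iUnion.2 ⟨n + 1, ?_⟩, hyFG⟩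
    rw [hD]
    exact Or.inr ⟨hyS, F, G, hn.1, hn.2, rfl⟩
  · have hDcard (n) : #(D B n) ≤ κ := by
      induction n with
      | zero => exact hB
      | succ n ih => rw [hD]; exact hcard _ κ hκ ih
    have := mk_iUnion_le_lift (D B)
    rw [Cardinal.lift_id', mk_nat, Cardinal.lift_aleph0] at this
    refine this.trans (mul_le_of_le hκ hκ ?_)
    exact ciSup_le' fun n ↦ by simpa using hDcard n

lemma hasTrimming_of_countable (hxV : ∀ x, x ∈ V x) (hS : S.Countable) : HasTrimming V S := by
  obtain ⟨e, he⟩ := countable_iff_exists_injOn.1 hS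
  have hfin (x) : {z ∈ S | e z < e x}.Finite :=
    ((Set.finite_lt_nat (e x)).subset (image_subset_iff.2 fun z hz ↦ hz.2)).of_finite_image
      (he.mono fun z hz ↦ hz.1)
  refine ⟨fun x ↦ (hfin x).toFinset, fun x _ ↦ by simp [Set.sep_subset], fun y hy ↦ ⟨?_, ?_⟩⟩
  · refine Set.Subsingleton.finite fun x hx z hz ↦ ?_
    obtain ⟨hxS, hyx⟩ := hx
    obtain ⟨hzS, hyz⟩ := hz
    simp only [mem_trim, Finite.mem_toFinset, mem_ofPred_eq] at hyx hyz
    exact he hxS hzS (le_antisymm (not_lt.1 fun h ↦ hyx.2 z ⟨hzS, h⟩ hyz.1)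
      (not_lt.1 fun h ↦ hyz.2 x ⟨hxS, h⟩ hyx.1))
  · obtain ⟨x, ⟨hxS, hyx⟩, hmin⟩ := exists_minimalFor_of_wellFoundedLT
      (fun x ↦ x ∈ S ∧ y ∈ V x) e ⟨y, hy, hxV y⟩
    refine ⟨x, hxS, mem_trim.2 ⟨hyx, fun z hz hyz ↦ ?_⟩⟩
    simp only [Finite.mem_toFinset, mem_ofPred_eq] at hz
    exact (hmin ⟨hz.1, hyz⟩ hz.2.le).not_gt hz.2

variable [TopologicalSpace X]

lemma IsReflecting.isCompact_inter (hxV : ∀ x, x ∈ V x) (hclopen : ∀ x, IsClopen (V x))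
    (hA : IsReflecting V S A) {K : Set X} (hK : IsCompact (K ∩ S)) : IsCompact (K ∩ A) := by
  have : K ∩ A = (K ∩ S) \ ⋃ z ∈ S \ A, V z := by
    ext y
    simp only [mem_inter_iff, mem_sdiff, mem_iUnion, not_exists]
    refine ⟨fun ⟨hy, hyA⟩ ↦ ⟨⟨hy, hA.subset hyA⟩, fun z hz hyz ↦
      hz.2 (hA.mem_of_mem y hyA z hz.1 hyz)⟩, fun ⟨⟨hy, hyS⟩, h⟩ ↦ ⟨hy, ?_⟩⟩
    by_contra hyA
    exact h y ⟨hyS, hyA⟩ (hxV y)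
  rw [this]
  exact hK.diff (isOpen_biUnion fun z _ ↦ (hclopen z).isOpen)

/-- A point of `S` has the same trace on the family `V x`, `x ∈ A`, as some point of `A`. -/
lemma IsReflecting.exists_retract (hxV : ∀ x, x ∈ V x) (hclopen : ∀ x, IsClopen (V x))
    (hcomp : ∀ x ∈ S, IsCompact (V x ∩ S)) (hA : IsReflecting V S A) {y x₀ : X} (hy : y ∈ S)
    (hx₀ : x₀ ∈ A) (hyx₀ : y ∈ V x₀) : ∃ y' ∈ A, ∀ x ∈ A, y' ∈ V x ↔ y ∈ V x := by
  classical
  obtain ⟨y', ⟨-, hy'A⟩, hy'⟩ := (hA.isCompact_inter hxV hclopen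
    (hcomp x₀ (hA.subset hx₀))).inter_iInter_nonempty
    (fun x : A ↦ {z | z ∈ V x ↔ y ∈ V x}) (fun x ↦ by
      by_cases h : y ∈ V x
      · simpa [h] using! (hclopen x).isClosed
      · simpa only [h, iff_false] using! (hclopen x).compl.isClosed) (fun u ↦ by
      let F : Finset X := u.map (.subtype _)
      have hF : ∀ x ∈ F, x ∈ A := by simp +contextual [F]
      obtain ⟨y', hy'A, h1, h2⟩ := hA.reflect (insert x₀ (F.filter (y ∈ V ·)))
        (F.filter (y ∉ V ·)) (Finset.insert_nonempty _ _)
        (fun x hx ↦ by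
          simp only [Finset.coe_insert, mem_insert_iff, Finset.mem_coe, Finset.mem_filter] at hx
          rcases hx with rfl | hx
          exacts [hx₀, hF x hx.1])
        (fun x hx ↦ hF x (Finset.mem_filter.1 hx).1)
        ⟨y, hy, by simp +contextual [hyx₀], by simp +contextual⟩
      refine ⟨y', ⟨h1 x₀ (by simp), hy'A⟩, mem_iInter₂.2 fun x hx ↦ ?_⟩
      have hxF : x.1 ∈ F := by simpa [F] using hx
      by_cases h : y ∈ V x
      · simpa [h] using h1 x (by simp [hxF, h])
      · simpa [h] using h2 x (by simp [hxF, h]))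
  exact ⟨y', hy'A, fun x hx ↦ mem_iInter.1 hy' ⟨x, hx⟩⟩

theorem hasTrimming_of_pointCountable (hxV : ∀ x, x ∈ V x) (hclopen : ∀ x, IsClopen (V x))
    (hV : ∀ y, {x | y ∈ V x}.Countable) (hcomp : ∀ x ∈ S, IsCompact (V x ∩ S)) :
    HasTrimming V S := by
  induction hκ : #S using WellFoundedLT.induction generalizing S with
  | ind κ ih =>
  subst hκ
  rcases le_or_gt #S ℵ₀ with hS | hS
  · exact hasTrimming_of_countable hxV (le_aleph0_iff_set_countable.1 hS)
  obtain ⟨α, _, _, hα, hαS⟩ : ∃ (α : Type u) (_ : LinearOrder α) (_ : WellFoundedLT α),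
      (#α).ord = typeLT α ∧ #α = #S :=
    ⟨(#S).ord.ToType, inferInstance, inferInstance, by simp, by simp⟩
  obtain ⟨e⟩ := Cardinal.eq.1 hαS
  obtain ⟨cl, hcl_mono, hcl⟩ := exists_reflecting_closure hV S
  let I (i : α) : Set X := (fun j ↦ (e j : X)) '' Iic i
  let B (i : α) : Set X := cl (I i)
  have hIS (i) : I i ⊆ S := by rintro _ ⟨j, -, rfl⟩; exact (e j).2
  have hBr (i) : IsReflecting V S (B i) := (hcl _ (hIS i)).1
  have hBmono : Monotone B := fun i j h ↦ hcl_mono (image_mono (Iic_subset_Iic.2 h))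
  have hBcard (i) : #(B i) < #S := by
    refine ((hcl _ (hIS i)).2.2 _ (le_max_left ℵ₀ _) (le_max_right ℵ₀ _)).trans_lt (max_lt hS ?_)
    exact mk_image_le.trans_lt (hαS ▸ mk_Iic_lt i hα (hαS ▸ hS.le))
  have hBcov (x) (hx : x ∈ S) : ∃ i, x ∈ B i :=
    ⟨e.symm ⟨x, hx⟩, (hcl _ (hIS _)).2.1 ⟨e.symm ⟨x, hx⟩, self_mem_Iic, by simp⟩⟩
  let A (i : α) : Set X := ⋃ j ∈ Iio i, B j
  let D (i : α) : Set X := B i \ A i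
  have hAr (i) : IsReflecting V S (A i) := .biUnion hBmono fun j _ ↦ hBr j
  have hDcov (x) (hx : x ∈ S) : ∃ i, x ∈ D i := by
    obtain ⟨i, hi, hmin⟩ := exists_minimal_of_wellFoundedLT (fun i ↦ x ∈ B i) (hBcov x hx)
    refine ⟨i, hi, fun h ↦ ?_⟩
    obtain ⟨j, hj, hxj⟩ := mem_iUnion₂.1 h
    exact (hmin hxj hj.le).not_gt hj
  have hDS (i) : D i ⊆ S := sdiff_subset.trans (hBr i).subset
  have hDA {i j} (h : i < j) : D i ⊆ A j := sdiff_subset.trans (subset_biUnion_of_mem (u := B) h)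
  have hDuniq {x i j} (hi : x ∈ D i) (hj : x ∈ D j) : i = j := by
    rcases lt_trichotomy i j with h | h | h
    exacts [(hj.2 (hDA h hi)).elim, h, (hi.2 (hDA h hj)).elim]
  have hDtrim (i) : HasTrimming V (D i) := by
    refine ih _ ((mk_le_mk_of_subset sdiff_subset).trans_lt (hBcard i)) (fun x hx ↦ ?_) rfl
    have : V x ∩ D i = V x ∩ B i := by
      ext y
      refine ⟨fun h ↦ ⟨h.1, h.2.1⟩, fun h ↦ ⟨h.1, h.2, fun hy ↦ ?_⟩⟩
      exact hx.2 ((hAr i).mem_of_mem y hy x (hDS i hx) h.1)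
    rw [this]
    exact (hBr i).isCompact_inter hxV hclopen (hcomp x (hDS i hx))
  choose H hHD hH using hDtrim
  have hlev (x) : ∃ i, x ∈ S → x ∈ D i := by
    by_cases hx : x ∈ S
    · exact (hDcov x hx).imp fun i hi _ ↦ hi
    · exact ⟨e.symm (Classical.choice (mk_ne_zero_iff.1 (aleph0_pos.trans hS).ne')),
        fun h ↦ (hx h).elim⟩
  choose l hl using hlev
  let G (x : X) : Finset X := H (l x) x
  have hG {x i} (hx : x ∈ D i) : G x = H i x := by
    rw [← hDuniq (hl x (hDS i hx)) hx]
  have htrim {x y i} (hx : x ∈ D i) : y ∈ trim V G x ↔ y ∈ trim V (H i) x := by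
    rw [mem_trim, mem_trim, hG hx]
  have hfin (i) : ∀ y ∈ D i, {x ∈ S | y ∈ trim V G x}.Finite := by
    induction i using WellFoundedLT.induction with
    | ind i IH =>
    intro y hy
    have hsub : {x ∈ S | y ∈ trim V G x} ⊆
        {x ∈ D i | y ∈ trim V (H i) x} ∪ {x ∈ A i | y ∈ trim V G x} := by
      rintro x ⟨hx, hyx⟩
      by_cases hxA : x ∈ A i
      · exact Or.inr ⟨hxA, hyx⟩
      · have hxD : x ∈ D i := ⟨(hBr i).mem_of_mem y hy.1 x hx (mem_trim.1 hyx).1, hxA⟩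
        exact Or.inl ⟨hxD, (htrim hxD).1 hyx⟩
    refine (((hH i) y hy).1.union ?_).subset hsub
    rcases {x ∈ A i | y ∈ trim V G x}.eq_empty_or_nonempty with h | ⟨x₀, hx₀, hyx₀⟩
    · rw [h]
      exact finite_empty
    obtain ⟨y', hy'A, hy'⟩ := (hAr i).exists_retract hxV hclopen hcomp (hDS i hy) hx₀
      (mem_trim.1 hyx₀).1
    obtain ⟨j, hj⟩ := hDcov y' ((hAr i).subset hy'A)
    have hji : j < i := by
      by_contra! h
      obtain ⟨k, hk, hy'k⟩ := mem_iUnion₂.1 hy'A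
      exact hj.2 (mem_iUnion₂.2 ⟨k, hk.trans_le h, hy'k⟩)
    refine (IH j hji y' hj).subset fun x ⟨hxA, hyx⟩ ↦ ⟨(hAr i).subset hxA, ?_⟩
    obtain ⟨k, hk⟩ := hDcov x ((hAr i).subset hxA)
    have hki : k < i := by
      by_contra! h
      obtain ⟨m, hm, hxm⟩ := mem_iUnion₂.1 hxA
      exact hk.2 (mem_iUnion₂.2 ⟨m, hm.trans_le h, hxm⟩)
    rw [mem_trim] at hyx ⊢
    refine ⟨(hy' x hxA).2 hyx.1, fun z hz ↦ ?_⟩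
    have hzA : z ∈ A i := hDA hki (hHD k x hk (by rwa [hG hk] at hz))
    exact mt (hy' z hzA).1 (hyx.2 z hz)
  refine ⟨G, fun x hx ↦ (hHD _ x (hl x hx)).trans (hDS _), fun y hy ↦ ?_⟩
  obtain ⟨i, hi⟩ := hDcov y hy
  refine ⟨hfin i y hi, ?_⟩
  obtain ⟨x, hx, hyx⟩ := (hH i y hi).2
  exact ⟨x, hDS i hx, (htrim hx).2 hyx⟩

end Trimming
section Rank

variable {X : Type*} [TopologicalSpace X]

lemma cbDeriv_antitone : Antitone (cbDeriv X) := fun a b hab ↦ by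
  rw [cbDeriv.eq_def X a, cbDeriv.eq_def X b]
  exact fun x hx ↦ mem_iInter.2 fun p ↦ mem_iInter.1 hx ⟨p.1, p.2.trans_le hab⟩

/-- If `X^(o) = ∅`, then there is a rank function into the ordinals below `o` for which every
point has a neighbourhood consisting of points of smaller rank. -/
lemma exists_rank_of_cbDeriv_eq_empty {o : Ordinal} (ho : cbDeriv X o = ∅) :
    ∃ ρ : X → Ordinal, (∀ x, ρ x < o) ∧
      ∀ x, ∃ U, IsOpen U ∧ x ∈ U ∧ ∀ y ∈ U, y ≠ x → ρ y < ρ x := by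
  have key (x : X) : ∃ b < o, x ∈ cbDeriv X b ∧ x ∉ closure (cbDeriv X b \ {x}) := by
    obtain ⟨c, hc, hmin⟩ := exists_minimal_of_wellFoundedLT (fun c ↦ x ∉ cbDeriv X c)
      ⟨o, by simp [ho]⟩
    have hco : c ≤ o := not_lt.1 fun h ↦ (hmin (y := o) (by simp [ho]) h.le).not_gt h
    rw [cbDeriv.eq_def] at hc
    obtain ⟨⟨b, hb⟩, hxb⟩ := not_forall.1 (mt mem_iInter.2 hc)
    have hxb' : x ∈ cbDeriv X b := by
      by_contra h
      exact (hmin h hb.le).not_gt hb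
    exact ⟨b, hb.trans_le hco, hxb', fun h ↦ hxb ⟨hxb', h⟩⟩
  choose ρ hρo hρ hρ' using key
  refine ⟨ρ, hρo, fun x ↦ ⟨(closure (cbDeriv X (ρ x) \ {x}))ᶜ, isClosed_closure.isOpen_compl,
    hρ' x, fun y hy hyx ↦ ?_⟩⟩
  by_contra! h
  exact hy (subset_closure ⟨cbDeriv_antitone h (hρ y), hyx⟩)

lemma IsScattered.totallyDisconnectedSpace [T1Space X] (h : IsScattered X) :
    TotallyDisconnectedSpace X := by
  refine ⟨fun t _ ht ↦ ?_⟩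
  by_contra hnt
  rw [not_subsingleton_iff] at hnt
  obtain ⟨x, hx, U, hU, hUt⟩ := h t hnt.nonempty
  have hxU : x ∈ U := (hUt.symm ▸ mem_singleton x : x ∈ U ∩ t).1
  obtain ⟨y, hy, hyx⟩ := preperfect_iff_nhds.1 (ht.preperfect_of_nontrivial hnt) x hx U
    (hU.mem_nhds hxU)
  rw [hUt] at hy
  exact hyx hy

lemma exists_isClopen_isCompact_subset [T2Space X] [LocallyCompactSpace X]
    [TotallyDisconnectedSpace X] {x : X} {U : Set X} (hU : IsOpen U) (hx : x ∈ U) :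
    ∃ V, IsClopen V ∧ IsCompact V ∧ x ∈ V ∧ V ⊆ U := by
  obtain ⟨K, hK, hxK, hKU⟩ := exists_compact_subset hU hx
  obtain ⟨V, hV, hxV, hVK⟩ := loc_compact_Haus_tot_disc_of_zero_dim.mem_nhds_iff.1
    (isOpen_interior.mem_nhds hxK)
  have hVK' := hVK.trans interior_subset
  exact ⟨V, hV, hK.of_isClosed_subset hV.isClosed hVK', hxV, hVK'.trans hKU⟩

lemma HereditarilyMetaLindelof.exists_pointCountable_refinement
    (h : HereditarilyMetaLindelof X) {ι : Type*} {O : ι → Set X} (hO : ∀ i, IsOpen (O i)) :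
    ∃ 𝒱 : Set (Set X), (∀ V ∈ 𝒱, IsOpen V) ∧ ⋃₀ 𝒱 = ⋃ i, O i ∧ (∀ V ∈ 𝒱, ∃ i, V ⊆ O i) ∧
      ∀ x, {V ∈ 𝒱 | x ∈ V}.Countable := by
  set Y := ⋃ i, O i with hY
  have hYo : IsOpen Y := isOpen_iUnion hO
  obtain ⟨𝒱, h1, h2, h3, h4⟩ := h Y (range fun i ↦ ((↑) : Y → X) ⁻¹' O i)
    (by rintro _ ⟨i, rfl⟩; exact (hO i).preimage continuous_subtype_val)
    (by
      refine eq_univ_of_forall fun y ↦ ?_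
      obtain ⟨i, hi⟩ := mem_iUnion.1 y.2
      exact ⟨_, ⟨i, rfl⟩, hi⟩)
  refine ⟨image ((↑) : Y → X) '' 𝒱, ?_, ?_, ?_, fun x ↦ ?_⟩
  · rintro _ ⟨V, hV, rfl⟩
    exact hYo.isOpenMap_subtype_val V (h1 V hV)
  · rw [← image_sUnion, h2, image_univ, Subtype.range_coe]
  · rintro _ ⟨V, hV, rfl⟩
    obtain ⟨_, ⟨i, rfl⟩, hi⟩ := h3 V hV
    exact ⟨i, image_subset_iff.2 hi⟩
  · by_cases hx : x ∈ Y
    · refine ((h4 ⟨x, hx⟩).image (image ((↑) : Y → X))).mono ?_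
      rintro _ ⟨⟨V, hV, rfl⟩, y, hy, rfl⟩
      exact ⟨V, ⟨hV, hy⟩, rfl⟩
    · refine countable_empty.mono ?_
      rintro _ ⟨⟨V, hV, rfl⟩, y, hy, rfl⟩
      exact hx y.2

lemma countable_Iic_of_lt_omega_one {o : Ordinal} (ho : o < ω₁) : (Iic o).Countable := by
  have h : Order.succ o < ω₁ := (isSuccLimit_omega 1).succ_lt ho
  rw [← Order.Iio_succ, ← le_aleph0_iff_set_countable, Cardinal.mk_Iio_ordinal, lift_le_aleph0]
  rw [← Cardinal.ord_aleph, lt_ord, ← succ_aleph0, Order.lt_succ_iff] at h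
  exact h

/-- If all ranks are countable, then a neighbourhood assignment in which every other point of
`U x` has smaller rank than `x` has a point-countable open shrinking. -/
lemma HereditarilyMetaLindelof.exists_pointCountable_assignment
    (h : HereditarilyMetaLindelof X) {ρ : X → Ordinal} (hρ : ∀ x, ρ x < ω₁) {U : X → Set X}
    (hU : ∀ x, IsOpen (U x)) (hxU : ∀ x, x ∈ U x) (hUρ : ∀ x, ∀ y ∈ U x, y ≠ x → ρ y < ρ x) :
    ∃ O : X → Set X, (∀ x, IsOpen (O x)) ∧ (∀ x, x ∈ O x) ∧ (∀ x, O x ⊆ U x) ∧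
      ∀ y, {x | y ∈ O x}.Countable := by
  choose 𝒲 hWo hWU hW hWc using fun a ↦ h.exists_pointCountable_refinement
    (O := fun x : {x // ρ x = a} ↦ U x) fun x ↦ hU x
  obtain ⟨𝒯, hTo, hTU, hT, hTc⟩ := h.exists_pointCountable_refinement hU
  have hw (x) : ∃ W ∈ 𝒲 (ρ x), x ∈ W ∧ W ⊆ U x := by
    have hx : x ∈ ⋃₀ 𝒲 (ρ x) := hWU _ ▸ mem_iUnion.2 ⟨⟨x, rfl⟩, hxU x⟩
    obtain ⟨W, hW', hxW⟩ := hx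
    obtain ⟨⟨z, hz⟩, hWz⟩ := hW _ W hW'
    obtain rfl : x = z := by
      by_contra hne
      exact (hUρ z x (hWz hxW) hne).ne hz.symm
    exact ⟨W, hW', hxW, hWz⟩
  have ht (x) : ∃ T ∈ 𝒯, x ∈ T := by
    have : x ∈ ⋃₀ 𝒯 := hTU ▸ mem_iUnion.2 ⟨x, hxU x⟩
    exact this
  choose w hw hxw hwU using hw
  choose t ht hxt using ht
  refine ⟨fun x ↦ w x ∩ t x, fun x ↦ (hWo _ _ (hw x)).inter (hTo _ (ht x)),
    fun x ↦ ⟨hxw x, hxt x⟩, fun x ↦ inter_subset_left.trans (hwU x), fun y ↦ ?_⟩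
  have hrank (a) : {x | ρ x = a ∧ y ∈ w x}.Countable := by
    refine MapsTo.countable_of_injOn (f := w) ?_ ?_ (hWc a y)
    · rintro x ⟨rfl, hx⟩
      exact ⟨hw x, hx⟩
    · intro x hx z hz hxz
      by_contra hne
      exact (hUρ z x (hwU z (hxz ▸ hxw x)) hne).ne (hx.1.trans hz.1.symm)
  have htrace (T) (hT' : T ∈ 𝒯) : {x | t x = T ∧ y ∈ w x}.Countable := by
    obtain ⟨z, hz⟩ := hT T hT'
    refine ((countable_Iic_of_lt_omega_one (hρ z)).biUnion fun a _ ↦ hrank a).mono ?_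
    rintro x ⟨rfl, hyx⟩
    refine mem_biUnion (x := ρ x) ?_ ⟨rfl, hyx⟩
    by_cases h : x = z
    · exact (congrArg ρ h).le
    · exact (hUρ _ x (hz (hxt x)) h).le
  refine ((hTc y).biUnion (t := fun T _ ↦ {x | t x = T ∧ y ∈ w x})
    fun T hT' ↦ htrace T hT'.1).mono fun x hx ↦ ?_
  exact mem_iUnion₂.2 ⟨t x, ⟨ht x, hx.2⟩, rfl, hx.1⟩

end Rank

/-- Every open cover of a hereditarily meta-Lindelöf, locally compact, scattered
Tychonoff space of Cantor–Bendixson height `ω₁` has a point-finite clopen refinement. -/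
theorem open_cover_has_pointFinite_clopen_refinement_of_height_omega1
    (X : Type u) [TopologicalSpace X] [T35Space X] [LocallyCompactSpace X]
    (hml : HereditarilyMetaLindelof X) (hsc : IsScattered X)
    (hht : cbHeight X = ω₁)
    (𝒰 : Set (Set X)) (hopen : ∀ U ∈ 𝒰, IsOpen U) (hcov : ⋃₀ 𝒰 = Set.univ) :
    ∃ 𝒱 : Set (Set X), (∀ V ∈ 𝒱, IsClopen V) ∧ ⋃₀ 𝒱 = Set.univ ∧
      (∀ V ∈ 𝒱, ∃ U ∈ 𝒰, V ⊆ U) ∧ ∀ x : X, {V ∈ 𝒱 | x ∈ V}.Finite := by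
  have hempty : cbDeriv X (ω₁) = ∅ := by
    have hne : {o : Ordinal | cbDeriv X o = ∅}.Nonempty := by
      by_contra h
      rw [cbHeight, not_nonempty_iff_eq_empty.1 h, Ordinal.sInf_empty] at hht
      exact (omega_pos 1).ne hht
    rw [← hht]
    exact csInf_mem hne
  have := hsc.totallyDisconnectedSpace
  obtain ⟨ρ, hρ, hU⟩ := exists_rank_of_cbDeriv_eq_empty hempty
  choose U hUo hxU hUρ using hU
  have hC (x) : ∃ C ∈ 𝒰, x ∈ C := mem_sUnion.1 (hcov ▸ mem_univ x)
  choose C hC hxC using hC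
  obtain ⟨O, hOo, hxO, hOUC, hOc⟩ := hml.exists_pointCountable_assignment hρ
    (U := fun x ↦ U x ∩ C x) (fun x ↦ (hUo x).inter (hopen _ (hC x)))
    (fun x ↦ ⟨hxU x, hxC x⟩) fun x y hy ↦ hUρ x y hy.1
  choose V hV hVc hxV hVO using fun x ↦ exists_isClopen_isCompact_subset (hOo x) (hxO x)
  obtain ⟨G, -, hG⟩ := hasTrimming_of_pointCountable (S := univ) hxV hV
    (fun y ↦ (hOc y).mono fun x hx ↦ hVO x hx) fun x _ ↦ by simpa using hVc x
  refine ⟨range (trim V G), ?_, eq_univ_of_forall fun y ↦ ?_, ?_, fun y ↦ ?_⟩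
  · rintro _ ⟨x, rfl⟩
    exact (hV x).diff ((G x).finite_toSet.isClopen_biUnion fun z _ ↦ hV z)
  · obtain ⟨x, -, hx⟩ := (hG y trivial).2
    exact ⟨_, ⟨x, rfl⟩, hx⟩
  · rintro _ ⟨x, rfl⟩
    exact ⟨C x, hC x, sdiff_subset.trans ((hVO x).trans ((hOUC x).trans inter_subset_right))⟩
  · refine ((hG y trivial).1.image (trim V G)).subset ?_
    rintro _ ⟨⟨x, rfl⟩, hx⟩
    exact ⟨x, ⟨trivial, hx⟩, rfl⟩
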